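/- arXiv:2204.07759 — 4 statements merged into one kernel-verified Lean document; each statement's English description precedes it below -/
import Mathlib

section
/- Let p be a prime, let j be an integer with 1 ≤ j ≤ p−2, and let V be a finite-dimensional representation of the group G = GL_2(F_p) over the field F_p such that for every c ∈ F_p^×, the scalar matrix c·I acts on V as multiplication by c^j. Then the group cohomology H^i(G, V) vanishes for every i ≥ 0. -/
open CategoryTheory

/-- If precomposition with a self-lift `φ` of the identity of `X` to a projective resolution acts on
`Hom(P, Y)` as a scalar `c` with `c - 1` invertible, then `Hom(P, Y)` is exact: `φ` is homotopic to
the identity, so `c - 1` acts as zero on cohomology. -/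
theorem CategoryTheory.ProjectiveResolution.exactAt_linearYonedaObj_of_comp_eq_smul
    {R C : Type*} [CommRing R] [Category C] [Abelian C] [Linear R C] {X : C}
    (P : ProjectiveResolution X) (Y : C) (φ : P.complex ⟶ P.complex) (hφ : φ ≫ P.π = P.π)
    (c : R) (hc : IsUnit (c - 1)) (h : ∀ n (f : P.complex.X n ⟶ Y), φ.f n ≫ f = c • f) (n : ℕ) :
    (P.complex.linearYonedaObj R Y).ExactAt n := by
  have H : Homotopy (φ - 𝟙 P.complex) 0 :=
    ProjectiveResolution.liftHomotopyZero _ (by simp [hφ])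
  rw [HomologicalComplex.exactAt_iff' _ (n - 1) n (n + 1) (by cases n <;> simp) (by simp),
    ShortComplex.moduleCat_exact_iff]
  intro (f : P.complex.X n ⟶ Y) (hf : P.complex.d (n + 1) n ≫ f = 0)
  obtain ⟨u, hu⟩ := hc
  have key : (P.complex.d n (n - 1) ≫ H.hom (n - 1) n) ≫ f = (u : R) • f := by
    have := congr($(H.comm n) ≫ f)
    rw [dNext_nat, prevD_eq (j' := n + 1) _ (by simp)] at this
    simp [hf, h] at this
    simp [← this, hu, sub_smul]
  refine ⟨(↑u⁻¹ : R) • (H.hom (n - 1) n ≫ f : P.complex.X (n - 1) ⟶ Y), ?_⟩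
  change P.complex.d n (n - 1) ≫ ((↑u⁻¹ : R) • (H.hom (n - 1) n ≫ f)) = f
  rw [Linear.comp_smul, ← Category.assoc, key, smul_smul, Units.inv_mul, one_smul]

/-- The action of a central element as an endomorphism of a representation. -/
noncomputable def Rep.centralHom {k G : Type*} [CommRing k] [Group G] (A : Rep k G) (z : G)
    (hz : z ∈ Subgroup.center G) : A ⟶ A :=
  Rep.ofHom ⟨A.ρ z, fun g => by
    rw [← Module.End.mul_eq_comp, ← Module.End.mul_eq_comp, ← map_mul, ← map_mul,
      Subgroup.mem_center_iff.1 hz g]⟩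

theorem Rep.centralHom_comm {k G : Type*} [CommRing k] [Group G] {A B : Rep k G} (f : A ⟶ B)
    (z : G) (hz : z ∈ Subgroup.center G) :
    A.centralHom z hz ≫ f = f ≫ B.centralHom z hz := by
  ext x
  exact Rep.hom_comm_apply f z x

/-- If a central element of `G` acts on `A` as a scalar `c` with `c - 1` invertible, then the
cohomology of `G` with coefficients in `A` vanishes. -/
theorem groupCohomology.subsingleton_of_central_smul {k G : Type} [CommRing k] [Group G]
    (A : Rep k G) (z : G) (hz : z ∈ Subgroup.center G) (c : k) (hc : IsUnit (c - 1))
    (h : ∀ a : A, A.ρ z a = c • a) (n : ℕ) : Subsingleton (groupCohomology A n) := by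
  let P := Rep.barResolution k G
  let φ : P.complex ⟶ P.complex :=
    { f i := (P.complex.X i).centralHom z hz
      comm' i j _ := Rep.centralHom_comm _ z hz }
  have hφ : φ ≫ P.π = P.π := by
    ext1
    rw [HomologicalComplex.comp_f]
    change (P.complex.X 0).centralHom z hz ≫ P.π.f 0 = P.π.f 0
    rw [Rep.centralHom_comm]
    convert Category.comp_id _
    ext
    rfl
  have hs : ∀ i (f : P.complex.X i ⟶ A), φ.f i ≫ f = c • f := by
    intro i f
    refine (Rep.centralHom_comm f z hz).trans ?_
    ext x
    exact h _
  have hE := P.exactAt_linearYonedaObj_of_comp_eq_smul A φ hφ c hc hs n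
  exact ModuleCat.subsingleton_of_isZero
    (hE.isZero_homology.of_iso (groupCohomologyIso A n P))

theorem ZMod.exists_unit_pow_ne_one {p : ℕ} [Fact p.Prime] {j : ℕ} (hj1 : 1 ≤ j)
    (hj2 : j ≤ p - 2) : ∃ c : (ZMod p)ˣ, c ^ j ≠ 1 := by
  obtain ⟨g, hg⟩ := IsCyclic.exists_ofOrder_eq_natCard (α := (ZMod p)ˣ)
  refine ⟨g, fun h => ?_⟩
  have hle := Nat.le_of_dvd hj1 (orderOf_dvd_of_pow_eq_one h)
  rw [hg, Nat.card_eq_fintype_card, ZMod.card_units] at hle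
  omega


/-- Let `p` be a prime, `1 ≤ j ≤ p - 2`, and `V` a finite-dimensional
representation of `G = GL₂(𝔽_p)` over `𝔽_p` on which every scalar matrix `c • I`
(for `c ∈ 𝔽_p ˣ`) acts as multiplication by `c ^ j`. Then `H^i(G, V) = 0` for all `i ≥ 0`. -/
theorem stmt1 (p : ℕ) [Fact p.Prime] (j : ℕ) (hj1 : 1 ≤ j) (hj2 : j ≤ p - 2)
    (V : Rep (ZMod p) (GL (Fin 2) (ZMod p))) [FiniteDimensional (ZMod p) V]
    (hscalar : ∀ (c : (ZMod p)ˣ) (g : GL (Fin 2) (ZMod p)),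
      (g : Matrix (Fin 2) (Fin 2) (ZMod p)) = (c : ZMod p) • (1 : Matrix (Fin 2) (Fin 2) (ZMod p)) →
      ∀ v : V, V.ρ g v = ((c : ZMod p) ^ j) • v) :
    ∀ i : ℕ, Subsingleton (groupCohomology V i) := by
  obtain ⟨c, hc⟩ := ZMod.exists_unit_pow_ne_one hj1 hj2
  let z : GL (Fin 2) (ZMod p) := Matrix.GeneralLinearGroup.scalar (Fin 2) c
  have hz : z ∈ Subgroup.center (GL (Fin 2) (ZMod p)) := by
    rw [Matrix.GeneralLinearGroup.center_eq_range_scalar]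
    exact ⟨c, rfl⟩
  refine groupCohomology.subsingleton_of_central_smul V z hz ((c : ZMod p) ^ j) ?_
    (hscalar c z ?_)
  · rw [isUnit_iff_ne_zero, sub_ne_zero]
    exact fun h => hc (Units.ext (by simpa using h))
  · simp [z, Matrix.smul_one_eq_diagonal]
end

section
/- Let p be a prime, n ≥ 1 an integer, and j an integer with 1 ≤ j ≤ p−2. Let t be an element of Z/p^nZ and let a_0, a_1, …, a_j ∈ Z/p^nZ. Then the vector a = (a_0, …, a_j) satisfies U_j(t)·a = a (i.e., for every r with 0 ≤ r ≤ j one has Σ_{k=r}^{j} binom(k, r)·t^{k−r}·a_k = a_r) if and only if a_i·t = 0 in Z/p^nZ for every i with 1 ≤ i ≤ j. -/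
/-- `U R j t` is the `(j+1) × (j+1)` matrix over `R` whose `(r, k)` entry is
`(k.choose r) • t ^ (k - r)` for `r ≤ k` and `0` otherwise: the `j`-th symmetric power of
the unipotent matrix `[[1, t], [0, 1]]`. -/
def U (R : Type) [CommRing R] (j : ℕ) (t : R) : Matrix (Fin (j + 1)) (Fin (j + 1)) R :=
  fun r k => if (r : ℕ) ≤ (k : ℕ) then ((k : ℕ).choose (r : ℕ) : R) * t ^ ((k : ℕ) - (r : ℕ)) else 0

theorem U_apply_self {R : Type} [CommRing R] {j : ℕ} (t : R) (r : Fin (j + 1)) :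
    U R j t r r = 1 := by
  simp [U]

theorem U_mul_eq_zero {R : Type} [CommRing R] {j : ℕ} {t x : R} {r k : Fin (j + 1)}
    (hrk : r ≠ k) (h : r < k → x * t = 0) : U R j t r k * x = 0 := by
  rcases lt_or_gt_of_ne hrk with hlt | hgt
  · obtain ⟨d, hd⟩ := Nat.exists_eq_add_of_lt (Fin.lt_def.mp hlt)
    have hle : (r : ℕ) ≤ k := hlt.le
    have hsub : (k : ℕ) - r = d + 1 := by omega
    simp only [U, if_pos hle, hsub]
    linear_combination (((k : ℕ).choose r : R) * t ^ d) * h hlt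
  · simp [U, not_le.mpr (Fin.lt_def.mp hgt)]

/-- If every positive integer up to `j` is invertible in `R`, the vectors fixed by `U R j t` are
those whose entries of positive index are annihilated by `t`. -/
theorem U_mulVec_eq_self_iff {R : Type} [CommRing R] {j : ℕ}
    (hunit : ∀ i : ℕ, 1 ≤ i → i ≤ j → IsUnit (i : R)) (t : R) (a : Fin (j + 1) → R) :
    (U R j t).mulVec a = a ↔ ∀ i : Fin (j + 1), 1 ≤ (i : ℕ) → a i * t = 0 := by
  constructor
  · intro h i
    induction i using WellFoundedGT.induction with
    | ind i ih =>
      intro hi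
      let r : Fin (j + 1) := ⟨i - 1, by omega⟩
      have hr : (r : ℕ) + 1 = i := Nat.sub_add_cancel hi
      have hri : r ≠ i := fun e => by rw [e] at hr; omega
      have hrow : ∑ k, U R j t r k * a k = a r := congrFun h r
      rw [Fintype.sum_eq_add r i hri fun k hk => U_mul_eq_zero hk.1.symm fun hlt => ih k (by
        have := Fin.val_ne_of_ne hk.2
        rw [Fin.lt_def] at hlt
        rw [Fin.lt_def]
        omega) (by rw [Fin.lt_def] at hlt; omega), U_apply_self, one_mul, add_eq_left] at hrow
      have hentry : U R j t r i = ((i : ℕ) : R) * t := by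
        simp [U, ← hr]
      rw [hentry, mul_assoc, (hunit i hi (by omega)).mul_right_eq_zero] at hrow
      rwa [mul_comm]
  · intro h
    ext r
    change ∑ k, U R j t r k * a k = a r
    rw [Fintype.sum_eq_single r fun k hk => U_mul_eq_zero hk.symm fun hlt => h k (by
      rw [Fin.lt_def] at hlt; omega), U_apply_self, one_mul]

/-- For a prime `p`, `n ≥ 1`, `1 ≤ j ≤ p - 2`, `t ∈ ℤ/p^n` and
`a = (a_0, …, a_j)` over `ℤ/p^n`, one has `U_j(t) · a = a` iff `a_i · t = 0` for all
`1 ≤ i ≤ j`. -/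
theorem stmt3 (p : ℕ) (hp : p.Prime) (n : ℕ) (hn : 1 ≤ n) (j : ℕ) (hj1 : 1 ≤ j)
    (hj2 : j ≤ p - 2) (t : ZMod (p ^ n)) (a : Fin (j + 1) → ZMod (p ^ n)) :
    (U (ZMod (p ^ n)) j t).mulVec a = a ↔ ∀ i : Fin (j + 1), 1 ≤ (i : ℕ) → a i * t = 0 := by
  refine U_mulVec_eq_self_iff (fun i hi hij => ?_) t a
  rw [ZMod.isUnit_iff_coprime]
  exact (Nat.coprime_of_lt_prime (by omega) (by omega) hp).symm.pow_right n
end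

section
/- Let p be a prime, n ≥ 1 an integer, and j an integer with 1 ≤ j ≤ p−2. Let t ∈ Z/p^nZ and a_0, a_1, …, a_j ∈ Z/p^nZ. Suppose that for every i with 0 ≤ i ≤ j−1 one has Σ_{k=i+1}^{j} binom(k, i)·a_k·t^{k−i} = 0 in Z/p^nZ. Then a_i·t = 0 in Z/p^nZ for every i with 1 ≤ i ≤ j. -/
/-- For a prime `p`, `n ≥ 1`, `1 ≤ j ≤ p - 2`, `t ∈ ℤ/p^n` and elements
`a_0, …, a_j ∈ ℤ/p^n`: if `∑_{k = i+1}^{j} C(k, i) · a_k · t^(k - i) = 0` for every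
`0 ≤ i ≤ j - 1`, then `a_i · t = 0` for every `1 ≤ i ≤ j`. -/
theorem stmt4 (p : ℕ) (hp : p.Prime) (n : ℕ) (hn : 1 ≤ n) (j : ℕ) (hj1 : 1 ≤ j)
    (hj2 : j ≤ p - 2) (t : ZMod (p ^ n)) (a : ℕ → ZMod (p ^ n))
    (h : ∀ i : ℕ, i ≤ j - 1 →
      ∑ k ∈ Finset.Icc (i + 1) j, (k.choose i : ZMod (p ^ n)) * a k * t ^ (k - i) = 0) :
    ∀ i : ℕ, 1 ≤ i → i ≤ j → a i * t = 0 := by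
  intro i hi hij
  induction hd : j - i using Nat.strong_induction_on generalizing i with
  | _ d ih =>
    have hsum := h (i - 1) (by omega)
    rw [Nat.sub_add_cancel hi, Finset.sum_eq_single_of_mem i (by simp [hij])] at hsum
    · have hchoose : i.choose (i - 1) = i := by
        obtain ⟨m, rfl⟩ := Nat.exists_eq_add_of_le' hi
        simp
      have hcop : i.Coprime (p ^ n) :=
        (Nat.coprime_of_lt_prime (n := i) (by omega) (by omega) hp).symm.pow_right n
      have hunit : IsUnit (i : ZMod (p ^ n)) := (ZMod.isUnit_iff_coprime i (p ^ n)).2 hcop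
      rw [hchoose, Nat.sub_sub_self hi, pow_one, mul_assoc] at hsum
      exact hunit.mul_right_eq_zero.1 hsum
    · intro k hk hki
      obtain ⟨hik, hkj⟩ := Finset.mem_Icc.1 hk
      have hkt : a k * t = 0 := ih (j - k) (by omega) k (by omega) hkj rfl
      obtain ⟨m, hm⟩ : ∃ m, k - (i - 1) = m + 1 := ⟨k - i, by omega⟩
      rw [hm, pow_succ']
      linear_combination (k.choose (i - 1) : ZMod (p ^ n)) * t ^ m * hkt
end

section
/- Let p be a prime, n ≥ 1 an integer, and j an integer with 1 ≤ j ≤ p−2. Let t ∈ Z/p^nZ be a unit of Z/p^nZ and let a = (a_0, a_1, …, a_j) ∈ (Z/p^nZ)^{j+1}. Then U_j(t)·a = a if and only if a_i = 0 for every i with 1 ≤ i ≤ j; that is, the fixed vectors of U_j(t) are exactly the multiples of the first standard basis vector. -/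
/-- If `a` vanishes beyond index `r + 1`, only two terms survive in row `r` of `U R j t * a`. -/
theorem U_mulVec_of_eq_zero {R : Type} [CommRing R] {j : ℕ} (t : R) (a : Fin (j + 1) → R)
    {r s : Fin (j + 1)} (hs : (s : ℕ) = r + 1) (ha : ∀ k, s < k → a k = 0) :
    (U R j t).mulVec a r = a r + (s : ℕ) * t * a s := by
  have hrs : r ≠ s := by rintro rfl; omega
  rw [Matrix.mulVec, dotProduct, ← Finset.sum_subset (Finset.subset_univ {r, s}),
    Finset.sum_pair hrs]
  · simp [U, hs]
  · intro k _ hk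
    simp only [Finset.mem_insert, Finset.mem_singleton, not_or, Fin.ext_iff] at hk
    by_cases h : s < k
    · rw [ha k h, mul_zero]
    · have hkr : ¬ (r : ℕ) ≤ k := by rw [Fin.lt_def] at h; omega
      simp [U, hkr]

/-- If `t` and `1, …, j` are units, a fixed vector of `U R j t` vanishes outside index `0`. -/
theorem eq_zero_of_U_mulVec_eq_self {R : Type} [CommRing R] {j : ℕ} {t : R} (ht : IsUnit t)
    (hR : ∀ i : ℕ, 1 ≤ i → i ≤ j → IsUnit (i : R)) {a : Fin (j + 1) → R}
    (ha : (U R j t).mulVec a = a) (i : Fin (j + 1)) (hi : 1 ≤ (i : ℕ)) : a i = 0 := by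
  induction i using WellFoundedGT.induction with
  | ind i ih =>
    have h := U_mulVec_of_eq_zero t a (r := ⟨i - 1, by omega⟩) (s := i)
      (by simp only; omega) fun k hk => ih k hk (hi.trans (le_of_lt hk))
    rw [ha, left_eq_add] at h
    exact (((hR i hi (by omega)).mul ht).mul_right_eq_zero).1 h

/-- A vector supported at index `0` is fixed by `U R j t`. -/
theorem U_mulVec_eq_self {R : Type} [CommRing R] {j : ℕ} (t : R) {a : Fin (j + 1) → R}
    (ha : ∀ i : Fin (j + 1), 1 ≤ (i : ℕ) → a i = 0) : (U R j t).mulVec a = a := by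
  ext r
  rw [Matrix.mulVec, dotProduct, Finset.sum_eq_single 0]
  · by_cases hr : (r : ℕ) = 0
    · obtain rfl : r = 0 := Fin.ext hr
      simp [U]
    · simp [U, hr, ha r (by omega)]
  · intro k _ hk
    rw [ha k (Nat.one_le_iff_ne_zero.2 fun h => hk (Fin.ext h)), mul_zero]
  · simp

/-- For a prime `p`, `n ≥ 1`, `1 ≤ j ≤ p - 2` and a unit `t` of `ℤ/p^n`,
a vector `a` satisfies `U_j(t) · a = a` iff `a_i = 0` for all `1 ≤ i ≤ j`, i.e. the fixed
vectors of `U_j(t)` are exactly the multiples of the first standard basis vector. -/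
theorem stmt5 (p : ℕ) (hp : p.Prime) (n : ℕ) (hn : 1 ≤ n) (j : ℕ) (hj1 : 1 ≤ j)
    (hj2 : j ≤ p - 2) (t : ZMod (p ^ n)) (ht : IsUnit t) (a : Fin (j + 1) → ZMod (p ^ n)) :
    (U (ZMod (p ^ n)) j t).mulVec a = a ↔ ∀ i : Fin (j + 1), 1 ≤ (i : ℕ) → a i = 0 := by
  refine ⟨fun h => eq_zero_of_U_mulVec_eq_self ht (fun i hi hij => ?_) h, U_mulVec_eq_self t⟩
  rw [ZMod.isUnit_iff_coprime]
  exact (Nat.coprime_of_lt_prime (by omega) (by omega) hp).symm.pow_right n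
end
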